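/- Let Ω ⊆ ℝᵈ be open and φ : Ω → ℝ^{n+1} a nondegenerate n-times differentiable map (in the sense of Pyartli). Then for every nonzero linear functional ℓ : ℝ^{n+1} → ℝ, the set {s ∈ Ω : ℓ(φ(s)) = 0} has Lebesgue measure zero. -/

import Mathlib

open MeasureTheory

/-- `φ` is nondegenerate at `s` in the sense of Pyartli: the derivative `Dφ(s)` is injective
with image `𝒯`, and there exist a complement `ℒ ∋ φ(s)` of `𝒯` and a nonzero `v ∈ 𝒯` such
that the curve `r ↦ φ(Ω₁) ∩ (rv + ℒ)` is nondegenerate at `0`, i.e. its derivatives of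
orders `0, …, dim(ℝv + ℒ) - 1 = n + 1 - d` at `0` span `ℝv + ℒ`. -/
def PyartliNondegAt (d n : ℕ) (φ : (Fin d → ℝ) → (Fin (n + 1) → ℝ))
    (Ω : Set (Fin d → ℝ)) (s : Fin d → ℝ) : Prop :=
  Function.Injective (fderiv ℝ φ s) ∧
  ∃ (L : Submodule ℝ (Fin (n + 1) → ℝ)) (v : Fin (n + 1) → ℝ) (r₀ : ℝ)
    (ρ : ℝ → Fin (n + 1) → ℝ) (Ω₁ : Set (Fin d → ℝ)),
      φ s ∈ L ∧
      IsCompl (LinearMap.range (fderiv ℝ φ s).toLinearMap) L ∧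
      v ∈ LinearMap.range (fderiv ℝ φ s).toLinearMap ∧ v ≠ 0 ∧
      0 < r₀ ∧ IsOpen Ω₁ ∧ s ∈ Ω₁ ∧ Ω₁ ⊆ Ω ∧
      (∀ r : ℝ, |r| < r₀ → (φ '' Ω₁) ∩ {y | y - r • v ∈ L} = {ρ r}) ∧
      Submodule.span ℝ (Set.range (fun k : Fin (n + 2 - d) => iteratedDeriv (k : ℕ) ρ 0))
        = Submodule.span ℝ {v} ⊔ L

section Helpers

open Set Filter Topology Metric
open scoped Pointwise

/-- At almost every point of a set on which `f` vanishes, the derivative of `f` vanishes. -/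
theorem measure_fderiv_ne_zero_of_eqOn_zero {E F : Type*}
    [NormedAddCommGroup E] [NormedSpace ℝ E] [FiniteDimensional ℝ E]
    [MeasurableSpace E] [BorelSpace E] (μ : Measure E) [μ.IsAddHaarMeasure]
    [NormedAddCommGroup F] [NormedSpace ℝ F] (f : E → F) (s : Set E)
    (h0 : ∀ x ∈ s, f x = 0) (hf : ∀ x ∈ s, DifferentiableAt ℝ f x) :
    μ {x ∈ s | fderiv ℝ f x ≠ 0} = 0 := by
  have key : ∀ᵐ x ∂μ.restrict s, x ∈ s → fderiv ℝ f x = 0 := by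
    filter_upwards [Besicovitch.ae_tendsto_measure_inter_div μ s] with x hx xs
    set D := fderiv ℝ f x with hD
    ext z
    suffices H : ∀ ε : ℝ, 0 < ε → ‖D z‖ ≤ ε * (‖z‖ + ε) + ‖D‖ * ε by
      have : Tendsto (fun ε : ℝ => ε * (‖z‖ + ε) + ‖D‖ * ε) (𝓝[>] 0)
          (𝓝 (0 * (‖z‖ + 0) + ‖D‖ * 0)) :=
        Tendsto.mono_left (Continuous.tendsto (by fun_prop) 0) nhdsWithin_le_nhds
      have h2 : ‖D z‖ ≤ 0 * (‖z‖ + 0) + ‖D‖ * 0 := by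
        apply le_of_tendsto_of_tendsto tendsto_const_nhds this
        filter_upwards [self_mem_nhdsWithin]
        exact H
      simpa using h2
    intro ε εpos
    have B₁ : ∀ᶠ r in 𝓝[>] (0 : ℝ), (s ∩ ({x} + r • closedBall z ε)).Nonempty :=
      Measure.eventually_nonempty_inter_smul_of_density_one μ s x hx _ measurableSet_closedBall
        (measure_closedBall_pos μ z εpos).ne'
    obtain ⟨ρ, ρpos, hρ⟩ :
      ∃ ρ > 0, ball x ρ ⊆ {y : E | ‖f y - f x - D (y - x)‖ ≤ ε * ‖y - x‖} :=
      Metric.mem_nhds_iff.1 ((hf x xs).hasFDerivAt.isLittleO.def εpos)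
    have B₂ : ∀ᶠ r in 𝓝[>] (0 : ℝ), {x} + r • closedBall z ε ⊆ ball x ρ := by
      apply nhdsWithin_le_nhds
      exact eventually_singleton_add_smul_subset isBounded_closedBall (ball_mem_nhds x ρpos)
    obtain ⟨r, ⟨y, ⟨ys, hy⟩⟩, rρ, rpos⟩ :
      ∃ r : ℝ,
        (s ∩ ({x} + r • closedBall z ε)).Nonempty ∧ {x} + r • closedBall z ε ⊆ ball x ρ ∧ 0 < r :=
      (B₁.and (B₂.and self_mem_nhdsWithin)).exists
    obtain ⟨a, az, ya⟩ : ∃ a, a ∈ closedBall z ε ∧ y = x + r • a := by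
      simp only [mem_smul_set, image_add_left, mem_preimage, singleton_add] at hy
      rcases hy with ⟨a, az, ha⟩
      exact ⟨a, az, by simp only [ha, add_neg_cancel_left]⟩
    have hza : ‖a - z‖ ≤ ε := mem_closedBall_iff_norm.1 az
    have norm_a : ‖a‖ ≤ ‖z‖ + ε := by
      have := norm_add_le z (a - z)
      rw [add_sub_cancel] at this
      linarith
    have h1 : ‖f y - f x - D (y - x)‖ ≤ ε * ‖y - x‖ := hρ (rρ hy)
    rw [h0 y ys, h0 x xs, ya, add_sub_cancel_left, map_smul, sub_zero, zero_sub, norm_neg,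
      norm_smul, norm_smul, Real.norm_eq_abs, abs_of_pos rpos] at h1
    have h3 : ‖D a‖ ≤ ε * ‖a‖ := by
      refine le_of_mul_le_mul_left ?_ rpos
      linarith
    have h4 : ‖D z‖ ≤ ‖D a‖ + ‖D (a - z)‖ := by
      have := norm_sub_le (D a) (D (a - z))
      rwa [← map_sub, sub_sub_cancel] at this
    have h5 : ‖D (a - z)‖ ≤ ‖D‖ * ε := (D.le_opNorm _).trans (by gcongr)
    have h6 : ε * ‖a‖ ≤ ε * (‖z‖ + ε) := by gcongr
    linarith
  refine le_antisymm ?_ zero_le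
  calc μ {x ∈ s | fderiv ℝ f x ≠ 0}
      ≤ μ ({x | ¬ (x ∈ s → fderiv ℝ f x = 0)} ∩ s) := by
        apply measure_mono
        rintro x ⟨hx, hx'⟩
        exact ⟨fun h => hx' (h hx), hx⟩
    _ ≤ μ.restrict s {x | ¬ (x ∈ s → fderiv ℝ f x = 0)} := Measure.le_restrict_apply _ _
    _ = 0 := key

/-- At almost every zero of a `C^n` function, the whole `n`-jet vanishes. -/
theorem measure_not_flat {E F : Type*}
    [NormedAddCommGroup E] [NormedSpace ℝ E] [FiniteDimensional ℝ E]
    [MeasurableSpace E] [BorelSpace E] (μ : Measure E) [μ.IsAddHaarMeasure]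
    [NormedAddCommGroup F] [NormedSpace ℝ F] (n : ℕ) (f : E → F) (s : Set E)
    (h0 : ∀ x ∈ s, f x = 0) (hf : ∀ x ∈ s, ContDiffAt ℝ n f x) (k : ℕ) (hk : k ≤ n) :
    μ {x ∈ s | ¬ ∀ j ≤ k, iteratedFDeriv ℝ j f x = 0} = 0 := by
  induction k with
  | zero =>
    convert measure_empty (μ := μ)
    ext x
    simp only [mem_ofPred_eq, mem_empty_iff_false, iff_false, not_and, not_not]
    intro hx j hj
    obtain rfl : j = 0 := by omega
    rw [← norm_eq_zero, norm_iteratedFDeriv_zero, h0 x hx, norm_zero]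
  | succ k ih =>
    have ih := ih (by omega)
    have h2 := measure_fderiv_ne_zero_of_eqOn_zero μ (iteratedFDeriv ℝ k f)
      {x ∈ s | ∀ j ≤ k, iteratedFDeriv ℝ j f x = 0} (fun x hx => hx.2 k le_rfl)
      (fun x hx => (hf x hx.1).differentiableAt_iteratedFDeriv (by exact_mod_cast hk))
    refine measure_mono_null ?_ (measure_union_null ih h2)
    rintro x ⟨hx, hx'⟩
    by_cases h : ∀ j ≤ k, iteratedFDeriv ℝ j f x = 0
    · right
      refine ⟨⟨hx, h⟩, fun h3 => hx' fun j hj => ?_⟩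
      rcases Nat.lt_or_ge k j with hj' | hj'
      · obtain rfl : j = k + 1 := by omega
        ext m
        rw [iteratedFDeriv_succ_apply_left, h3]
        rfl
      · exact h j hj'
    · exact Or.inl ⟨hx, h⟩

/-- If the `n`-jet of `g` vanishes at `f x`, so does the one of `g ∘ f` at `x`. -/
theorem iteratedFDeriv_comp_eq_zero_of_flat {E F G : Type*}
    [NormedAddCommGroup E] [NormedSpace ℝ E] [NormedAddCommGroup F] [NormedSpace ℝ F]
    [NormedAddCommGroup G] [NormedSpace ℝ G] (n : ℕ) (g : F → G) (f : E → F) (x : E)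
    (hg : ContDiffAt ℝ n g (f x)) (hf : ContDiffAt ℝ n f x)
    (h : ∀ j ≤ n, iteratedFDeriv ℝ j g (f x) = 0) (i : ℕ) (hi : i ≤ n) :
    iteratedFDeriv ℝ i (g ∘ f) x = 0 := by
  rw [iteratedFDeriv_comp hg hf (by exact_mod_cast hi)]
  refine Finset.sum_eq_zero fun c _ => ?_
  ext v
  have : ftaylorSeries ℝ g (f x) c.length = 0 := h _ (c.length_le.trans hi)
  rw [FormalMultilinearSeries.compAlongOrderedFinpartition_apply, this]
  rfl

/-- At a nondegenerate point, no nonzero functional composed with `φ` is flat to order `n`. -/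
theorem eq_zero_of_flat (d n : ℕ) (hd : 1 ≤ d) (hdn : d ≤ n)
    (Ω : Set (Fin d → ℝ)) (φ : (Fin d → ℝ) → (Fin (n + 1) → ℝ)) (s : Fin d → ℝ)
    (hdiff : ContDiffAt ℝ n φ s) (hnd : PyartliNondegAt d n φ Ω s)
    (ℓ : (Fin (n + 1) → ℝ) →L[ℝ] ℝ)
    (hflat : ∀ j ≤ n, iteratedFDeriv ℝ j (fun x => ℓ (φ x)) s = 0) : ℓ = 0 := by
  obtain ⟨hinj, L, v, r₀, ρ, Ω₁, hsL, hcompl, hvT, hv0, hr₀, hΩ₁, hsΩ₁, -, hρ, hspan⟩ := hnd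
  have hn0 : (n : WithTop ℕ∞) ≠ 0 := by
    have : n ≠ 0 := by omega
    exact_mod_cast this
  set A := fderiv ℝ φ s with hA
  have hφA : HasFDerivAt φ A s := (hdiff.differentiableAt hn0).hasFDerivAt
  -- the projection along `L` read in the source space
  obtain ⟨Q, hQA, hQL⟩ : ∃ Q : (Fin (n + 1) → ℝ) →L[ℝ] (Fin d → ℝ),
      (∀ w, Q (A w) = w) ∧ ∀ y, Q y = 0 ↔ y ∈ L := by
    let e := LinearEquiv.ofInjective A.toLinearMap hinj
    let P := Submodule.projectionOnto _ L hcompl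
    refine ⟨LinearMap.toContinuousLinearMap (e.symm.toLinearMap ∘ₗ P), fun w => ?_, fun y => ?_⟩
    · have h1 : P (A w) = e w :=
        Submodule.projectionOnto_apply_left hcompl (e w)
      simp [h1]
    · simp only [LinearMap.coe_toContinuousLinearMap', LinearMap.comp_apply, LinearEquiv.coe_coe,
        LinearEquiv.map_eq_zero_iff]
      exact Submodule.projectionOnto_apply_eq_zero_iff hcompl
  have hg : ContDiffAt ℝ n (fun x => Q (φ x)) s := Q.contDiff.contDiffAt.comp s hdiff
  have hg' : HasFDerivAt (fun x => Q (φ x))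
      ((ContinuousLinearEquiv.refl ℝ (Fin d → ℝ) : (Fin d → ℝ) →L[ℝ] (Fin d → ℝ))) s := by
    have h1 := Q.hasFDerivAt.comp s hφA
    have heq : Q.comp A = (ContinuousLinearEquiv.refl ℝ (Fin d → ℝ) :
        (Fin d → ℝ) →L[ℝ] (Fin d → ℝ)) := by
      refine ContinuousLinearMap.ext fun w => ?_
      simp [hQA]
    rw [heq] at h1
    exact h1
  have hgs : Q (φ s) = 0 := (hQL _).2 hsL
  let inv := hg.localInverse hg' hn0
  have hinv : ContDiffAt ℝ n inv 0 := by
    have := hg.to_localInverse hg' hn0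
    simpa only [hgs] using this
  have hinv0 : inv 0 = s := by
    have := hg.localInverse_apply_image hg' hn0
    simpa only [hgs] using this
  have hright : ∀ᶠ y in 𝓝 (0 : Fin d → ℝ), Q (φ (inv y)) = y := by
    have := (hg.hasStrictFDerivAt' hg' hn0).eventually_right_inverse
    simp only [hgs] at this
    exact this
  let γ : ℝ → (Fin d → ℝ) := fun r => inv (r • Q v)
  have hlin : ContDiff ℝ n (fun r : ℝ => r • Q v) := by fun_prop
  have hγ0 : γ 0 = s := by simp [γ, hinv0]
  have hγ : ContDiffAt ℝ n γ 0 := by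
    refine ContDiffAt.comp (g := inv) 0 ?_ hlin.contDiffAt
    simpa using hinv
  have hlin0 : Tendsto (fun r : ℝ => r • Q v) (𝓝 0) (𝓝 0) := by
    simpa using hlin.continuous.tendsto 0
  have hργ : ρ =ᶠ[𝓝 0] φ ∘ γ := by
    have h1 : ∀ᶠ r in 𝓝 (0 : ℝ), γ r ∈ Ω₁ :=
      hγ.continuousAt.eventually_mem (by rw [hγ0]; exact hΩ₁.mem_nhds hsΩ₁)
    have h2 : ∀ᶠ r in 𝓝 (0 : ℝ), |r| < r₀ := by
      filter_upwards [Metric.ball_mem_nhds (0 : ℝ) hr₀] with r hr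
      simpa using hr
    filter_upwards [h1, h2, hlin0.eventually hright] with r hr1 hr2 hr3
    have : φ (γ r) ∈ (φ '' Ω₁) ∩ {y | y - r • v ∈ L} := by
      refine ⟨⟨_, hr1, rfl⟩, ?_⟩
      rw [mem_ofPred_eq, ← hQL, map_sub, map_smul, sub_eq_zero]
      exact hr3
    rw [hρ r hr2] at this
    exact this.symm
  have hφγ : ContDiffAt ℝ n (φ ∘ γ) 0 :=
    ContDiffAt.comp 0 (by rw [hγ0]; exact hdiff) hγ
  have hℓφ : ContDiffAt ℝ n (fun x => ℓ (φ x)) s := ℓ.contDiff.contDiffAt.comp s hdiff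
  have hder : ∀ k ≤ n, ℓ (iteratedDeriv k ρ 0) = 0 := by
    intro k hk
    have h1 := iteratedFDeriv_comp_eq_zero_of_flat n (fun x => ℓ (φ x)) γ 0
      (by rw [hγ0]; exact hℓφ) hγ (by rw [hγ0]; exact hflat) k hk
    have h2 := ℓ.iteratedFDeriv_comp_left hφγ (i := k) (by exact_mod_cast hk)
    have h3 : iteratedFDeriv ℝ k (ℓ ∘ (φ ∘ γ)) 0 = 0 := h1
    rw [h3] at h2
    rw [hργ.iteratedDeriv_eq, iteratedDeriv_eq_iteratedFDeriv]
    have h4 := congrArg (fun m => m (fun _ => (1 : ℝ))) h2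
    simpa using h4.symm
  have hker : L ≤ LinearMap.ker ℓ.toLinearMap := by
    refine le_trans (le_sup_right (a := Submodule.span ℝ {v})) ?_
    rw [← hspan, Submodule.span_le]
    rintro _ ⟨k, rfl⟩
    exact hder k (by omega)
  have hT : LinearMap.range A.toLinearMap ≤ LinearMap.ker ℓ.toLinearMap := by
    rintro _ ⟨w, rfl⟩
    have h1 : HasFDerivAt (fun x => ℓ (φ x)) (ℓ.comp A) s := ℓ.hasFDerivAt.comp s hφA
    have h2 := hflat 1 (by omega)
    rw [← norm_eq_zero, norm_iteratedFDeriv_one, norm_eq_zero, h1.fderiv] at h2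
    exact congrArg (fun m => m w) h2
  have htop : (⊤ : Submodule ℝ (Fin (n + 1) → ℝ)) ≤ LinearMap.ker ℓ.toLinearMap := by
    rw [← hcompl.sup_eq_top]
    exact sup_le hT hker
  ext1 y
  exact htop (Submodule.mem_top (x := y))

end Helpers

/-- For a nondegenerate `n`-times differentiable map `φ : Ω → ℝ^{n+1}` on an open
`Ω ⊆ ℝᵈ`, the zero set of `ℓ ∘ φ` is Lebesgue-null for every nonzero functional `ℓ`. -/
theorem zero_set_null_of_nondegenerate (d n : ℕ) (hd : 1 ≤ d) (hdn : d ≤ n)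
    (Ω : Set (Fin d → ℝ)) (hΩ : IsOpen Ω)
    (φ : (Fin d → ℝ) → (Fin (n + 1) → ℝ))
    (hdiff : ∀ s ∈ Ω, ContDiffAt ℝ n φ s)
    (hnd : ∀ s ∈ Ω, PyartliNondegAt d n φ Ω s)
    (ℓ : (Fin (n + 1) → ℝ) →ₗ[ℝ] ℝ) (hℓ : ℓ ≠ 0) :
    volume {s ∈ Ω | ℓ (φ s) = 0} = 0 := by
  let ℓ' : (Fin (n + 1) → ℝ) →L[ℝ] ℝ := LinearMap.toContinuousLinearMap ℓ
  have h := measure_not_flat volume n (fun x => ℓ' (φ x)) {s ∈ Ω | ℓ (φ s) = 0}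
    (fun x hx => hx.2) (fun x hx => ℓ'.contDiff.contDiffAt.comp x (hdiff x hx.1)) n le_rfl
  refine measure_mono_null ?_ h
  intro s hs
  refine ⟨hs, fun hflat => hℓ ?_⟩
  have h0 := eq_zero_of_flat d n hd hdn Ω φ s (hdiff s hs.1) (hnd s hs.1) ℓ' hflat
  refine LinearMap.ext fun y => ?_
  exact congrArg (fun m => m y) h0
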